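/- arXiv:cond-mat/0208065 — 4 statements merged into one kernel-verified Lean document; each statement's English description precedes it below -/
import Mathlib

section
/- For every β > 0, as N → ∞ the sequence exp(β N ε 0) · Z_N(β) converges, and its limit equals the convergent infinite product ∏_{j=1}^∞ (1 − exp(−β(ε j − ε 0)))^{−1}. -/
open scoped BigOperators
open Filter

noncomputable section

/-- The particle number of a configuration `n : ℕ →₀ ℕ`. -/
def particleNumber (n : ℕ →₀ ℕ) : ℕ := n.sum fun _ k => k

/-- The energy of a configuration `n`, with one-particle levels `ε`. -/
def energy (ε : ℕ → ℝ) (n : ℕ →₀ ℕ) : ℝ := n.sum fun j k => (k : ℝ) * ε j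

/-- The canonical partition function of `N` bosons at inverse temperature `β`. -/
def Z (ε : ℕ → ℝ) (β : ℝ) (N : ℕ) : ℝ :=
  ∑' n : {n : ℕ →₀ ℕ // particleNumber n = N}, Real.exp (-β * energy ε n)

/-- The sum of the monomials with exponents below `K` in the variables indexed by `s` is a product
of truncated geometric series. -/
theorem sum_finsupp_range_prod_pow {ι R : Type*} [CommSemiring R] (x : ι → R) (s : Finset ι)
    (K : ℕ) :
    ∑ m ∈ s.finsupp (fun _ => Finset.range K), m.prod (fun j k => x j ^ k) =
      ∏ j ∈ s, ∑ k ∈ Finset.range K, x j ^ k := by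
  classical
  rw [Finset.prod_sum, Finset.finsupp, Finset.sum_map]
  refine Finset.sum_congr rfl fun p _ => ?_
  rw [Function.Embedding.coeFn_mk,
    Finsupp.prod_of_support_subset _ (s := s) (Finsupp.support_indicator_subset _ _) _
      (fun _ _ => pow_zero _), ← Finset.prod_attach]
  refine Finset.prod_congr rfl fun i _ => ?_
  simp [Finsupp.indicator_of_mem i.2]

theorem multipliable_inv_one_sub {ι : Type*} {x : ι → ℝ} (h0 : ∀ j, 0 ≤ x j) (h1 : ∀ j, x j < 1)
    (hx : Summable x) : Multipliable fun j => (1 - x j)⁻¹ := by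
  have hev : ∀ᶠ j in cofinite, x j ≤ 1 / 2 :=
    hx.tendsto_cofinite_zero.eventually_le_const (by norm_num)
  have hs : Summable fun j => x j * (1 - x j)⁻¹ := by
    refine (hx.mul_right 2).of_norm_bounded_eventually ?_
    filter_upwards [hev] with j hj
    have hpos : 0 < 1 - x j := by linarith
    rw [Real.norm_of_nonneg (mul_nonneg (h0 j) (inv_nonneg.2 hpos.le))]
    refine mul_le_mul_of_nonneg_left ?_ (h0 j)
    rw [inv_le_comm₀ hpos two_pos]
    linarith
  refine (multipliable_one_add_of_summable hs.norm).congr fun j => ?_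
  have : 1 - x j ≠ 0 := (sub_pos.2 (h1 j)).ne'
  field_simp
  ring

/-- Expansion of the product of the geometric series of a summable family `x` as the sum over all
monomials in the `x j`. -/
theorem hasSum_prod_pow_finsupp {ι : Type*} {x : ι → ℝ} (h0 : ∀ j, 0 ≤ x j) (h1 : ∀ j, x j < 1)
    (hx : Summable x) :
    HasSum (fun m : ι →₀ ℕ => m.prod fun j k => x j ^ k) (∏' j, (1 - x j)⁻¹) := by
  classical
  have hmul := multipliable_inv_one_sub h0 h1 hx
  have hone (j : ι) : 1 ≤ (1 - x j)⁻¹ :=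
    (one_le_inv₀ (sub_pos.2 (h1 j))).2 (by linarith [h0 j])
  have hnonneg (m : ι →₀ ℕ) : 0 ≤ m.prod fun j k => x j ^ k :=
    Finset.prod_nonneg fun j _ => pow_nonneg (h0 j) _
  have hle (s : Finset ι) : ∏ j ∈ s, (1 - x j)⁻¹ ≤ ∏' j, (1 - x j)⁻¹ := by
    refine ge_of_tendsto hmul.hasProd (eventually_atTop.2 ⟨s, fun t hst => ?_⟩)
    exact Finset.prod_le_prod_of_subset_of_one_le hst
      (fun j _ => zero_le_one.trans (hone j)) fun j _ _ => hone j
  have hgeom (j : ι) := hasSum_geometric_of_lt_one (h0 j) (h1 j)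
  refine hasSum_of_isLUB_of_nonneg _ hnonneg ⟨?_, fun b hb => ?_⟩
  · rintro _ ⟨s, rfl⟩
    set F := s.biUnion Finsupp.support
    set K := s.sup (fun m => F.sup m) + 1
    have hsub : s ⊆ F.finsupp (fun _ => Finset.range K) := fun m hm => by
      refine Finset.mem_finsupp_iff.2 ⟨Finset.subset_biUnion_of_mem Finsupp.support hm,
        fun j hj => Finset.mem_range.2 (Nat.lt_succ_of_le ?_)⟩
      exact (Finset.le_sup (f := m) hj).trans
        (Finset.le_sup (f := fun m : ι →₀ ℕ => F.sup m) hm)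
    calc ∑ m ∈ s, m.prod (fun j k => x j ^ k)
        ≤ ∑ m ∈ F.finsupp (fun _ => Finset.range K), m.prod (fun j k => x j ^ k) :=
          Finset.sum_le_sum_of_subset_of_nonneg hsub fun m _ _ => hnonneg m
      _ = ∏ j ∈ F, ∑ k ∈ Finset.range K, x j ^ k := sum_finsupp_range_prod_pow x F K
      _ ≤ ∏ j ∈ F, (1 - x j)⁻¹ :=
          Finset.prod_le_prod (fun j _ => Finset.sum_nonneg fun k _ => pow_nonneg (h0 j) k)
            fun j _ => sum_le_hasSum _ (fun k _ => pow_nonneg (h0 j) k) (hgeom j)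
      _ ≤ _ := hle F
  · refine le_of_tendsto' hmul.hasProd fun s => ?_
    refine le_of_tendsto' (tendsto_finsetProd s fun j _ => (hgeom j).tendsto_sum_nat) fun K => ?_
    rw [← sum_finsupp_range_prod_pow]
    exact hb ⟨_, rfl⟩

/-- The occupation numbers of the excited levels, reindexed from `0`. -/
def excited (n : ℕ →₀ ℕ) : ℕ →₀ ℕ :=
  n.comapDomain Nat.succ Nat.succ_injective.injOn

@[simp]
theorem excited_apply (n : ℕ →₀ ℕ) (j : ℕ) : excited n j = n (j + 1) := rfl

theorem sum_eq_zero_add_sum_excited {M : Type*} [AddCommMonoid M] (n : ℕ →₀ ℕ) (h : ℕ → ℕ → M)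
    (h_zero : ∀ j, h j 0 = 0) :
    n.sum h = h 0 (n 0) + (excited n).sum fun j k => h (j + 1) k := by
  obtain ⟨K, hK⟩ := n.support.exists_nat_subset_range
  have hK' : n.support ⊆ Finset.range (K + 1) :=
    hK.trans (Finset.range_mono K.le_succ)
  have hE : (excited n).support ⊆ Finset.range K := fun j hj => by
    have : j + 1 ∈ Finset.range (K + 1) := hK' (by simpa using hj)
    simpa using this
  rw [Finsupp.sum_of_support_subset _ hK' _ fun j _ => h_zero j,
    Finsupp.sum_of_support_subset _ hE _ fun j _ => h_zero (j + 1), Finset.sum_range_succ',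
    add_comm]
  rfl

theorem particleNumber_eq_add_excited (n : ℕ →₀ ℕ) :
    particleNumber n = n 0 + particleNumber (excited n) :=
  sum_eq_zero_add_sum_excited n _ fun _ => rfl

theorem energy_eq_add_excited (ε : ℕ → ℝ) (n : ℕ →₀ ℕ) :
    energy ε n = n 0 * ε 0 + energy (fun j => ε (j + 1)) (excited n) :=
  sum_eq_zero_add_sum_excited n _ fun _ => by simp

theorem prod_exp_pow_eq_exp (ε : ℕ → ℝ) (β c : ℝ) (m : ℕ →₀ ℕ) :
    (m.prod fun j k => Real.exp (-β * (ε j - c)) ^ k) =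
      Real.exp (-β * (energy ε m - particleNumber m * c)) := by
  simp only [Finsupp.prod, energy, particleNumber, Finsupp.sum, ← Real.exp_nat_mul,
    ← Real.exp_sum]
  push_cast
  rw [Finset.sum_mul, ← Finset.sum_sub_distrib, Finset.mul_sum]
  congr 1
  exact Finset.sum_congr rfl fun j _ => by ring

theorem excited_injective_of_particleNumber_eq (N : ℕ) :
    Function.Injective fun n : {n : ℕ →₀ ℕ // particleNumber n = N} => excited n := by
  rintro ⟨n, hn⟩ ⟨n', hn'⟩ h
  have h : excited n = excited n' := h
  ext j
  cases j with
  | zero =>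
    rw [particleNumber_eq_add_excited] at hn hn'
    rw [h] at hn
    exact Nat.add_right_cancel (hn.trans hn'.symm)
  | succ j => exact DFunLike.congr_fun h j

theorem exists_excited_eq {N : ℕ} {m : ℕ →₀ ℕ} (hm : particleNumber m ≤ N) :
    ∃ n, particleNumber n = N ∧ excited n = m := by
  let n := m.embDomain ⟨Nat.succ, Nat.succ_injective⟩ + Finsupp.single 0 (N - particleNumber m)
  have he : excited n = m := by
    ext j
    have := Finsupp.embDomain_apply_self ⟨Nat.succ, Nat.succ_injective⟩ m j
    simpa [n] using this
  have h0 : n 0 = N - particleNumber m := by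
    have := Finsupp.embDomain_of_notMem_range ⟨Nat.succ, Nat.succ_injective⟩ m 0 (by simp)
    simpa [n] using this
  refine ⟨n, ?_, he⟩
  rw [particleNumber_eq_add_excited, he, h0]
  omega

/-- After rescaling by the ground-state energy, the canonical partition function is the sum over
the excited configurations with at most `N` particles. -/
theorem exp_mul_Z_eq_tsum_indicator (ε : ℕ → ℝ) (β : ℝ) (N : ℕ) :
    Real.exp (β * N * ε 0) * Z ε β N =
      ∑' m : ℕ →₀ ℕ, {m : ℕ →₀ ℕ | particleNumber m ≤ N}.indicator
        (fun m => m.prod fun j k => Real.exp (-β * (ε (j + 1) - ε 0)) ^ k) m := by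
  rw [Z, ← tsum_mul_left, ← (excited_injective_of_particleNumber_eq N).tsum_eq]
  · refine tsum_congr fun ⟨n, hn⟩ => ?_
    have hN := particleNumber_eq_add_excited n
    rw [hn] at hN
    rw [Set.indicator_of_mem
        (show excited n ∈ {m : ℕ →₀ ℕ | particleNumber m ≤ N} from by simp; omega),
      prod_exp_pow_eq_exp (fun j => ε (j + 1)), ← Real.exp_add, energy_eq_add_excited]
    congr 1
    have hN' : (N : ℝ) = n 0 + particleNumber (excited n) := mod_cast hN
    linear_combination β * ε 0 * hN'
  · intro m hm
    have hmN : m ∈ {m : ℕ →₀ ℕ | particleNumber m ≤ N} := Set.mem_of_indicator_ne_zero hm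
    obtain ⟨n, hn, rfl⟩ := exists_excited_eq hmN
    exact ⟨⟨n, hn⟩, rfl⟩

/-- For every `β > 0`, the sequence `exp (β N ε 0) * Z_N(β)` converges as `N → ∞`, and its
limit is the convergent infinite product `∏_{j=1}^∞ (1 - exp (-β (ε j - ε 0)))⁻¹`. -/
theorem scaled_partition_function_tendsto (ε : ℕ → ℝ) (hmono : Monotone ε) (hgap : ε 0 < ε 1)
    (htrace : ∀ β : ℝ, 0 < β → Summable fun j => Real.exp (-β * ε j))
    (β : ℝ) (hβ : 0 < β) :
    (Multipliable fun j : ℕ => (1 - Real.exp (-β * (ε (j + 1) - ε 0)))⁻¹) ∧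
    Tendsto (fun N : ℕ => Real.exp (β * N * ε 0) * Z ε β N) atTop
      (nhds (∏' j : ℕ, (1 - Real.exp (-β * (ε (j + 1) - ε 0)))⁻¹)) := by
  set x : ℕ → ℝ := fun j => Real.exp (-β * (ε (j + 1) - ε 0)) with hx_def
  have h0 (j : ℕ) : 0 ≤ x j := (Real.exp_pos _).le
  have h1 (j : ℕ) : x j < 1 := by
    have : ε 1 ≤ ε (j + 1) := hmono (by omega)
    rw [hx_def, Real.exp_lt_one_iff]
    exact mul_neg_of_neg_of_pos (neg_lt_zero.2 hβ) (by linarith)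
  have hx : Summable x := by
    refine (((summable_nat_add_iff 1).2 (htrace β hβ)).mul_left (Real.exp (β * ε 0))).congr
      fun j => ?_
    rw [← Real.exp_add, hx_def]
    ring_nf
  have hsum := hasSum_prod_pow_finsupp h0 h1 hx
  refine ⟨multipliable_inv_one_sub h0 h1 hx, ?_⟩
  simp only [exp_mul_Z_eq_tsum_indicator]
  rw [← hsum.tsum_eq]
  refine tendsto_tsum_of_dominated_convergence hsum.summable (fun m => ?_)
    (Eventually.of_forall fun N m => ?_)
  · refine tendsto_const_nhds.congr' ?_
    filter_upwards [eventually_ge_atTop (particleNumber m)] with N hN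
    rw [Set.indicator_of_mem (show m ∈ {m : ℕ →₀ ℕ | particleNumber m ≤ N} from hN)]
  · have hm : 0 ≤ m.prod fun j k => x j ^ k :=
      Finset.prod_nonneg fun j _ => pow_nonneg (h0 j) _
    exact (norm_indicator_le_norm_self _ _).trans_eq (Real.norm_of_nonneg hm)
end
end

section
/- For every β > 0, the probability that all particles occupy the ground state converges as N → ∞: P_N({n : N'(n) = 0}) = exp(−β N ε 0)/Z_N(β) → ∏_{j=1}^∞ (1 − exp(−β(ε j − ε 0))), and this limit is strictly positive. -/
open scoped BigOperators
open Filter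

noncomputable section

/-- The canonical Gibbs probability of the set `A` of configurations, among configurations
with particle number `N`. -/
def P (ε : ℕ → ℝ) (β : ℝ) (N : ℕ) (A : Set (ℕ →₀ ℕ)) : ℝ :=
  (∑' n : {n : ℕ →₀ ℕ // particleNumber n = N ∧ n ∈ A},
      Real.exp (-β * energy ε n)) / Z ε β N

/-- The configuration with `k` particles in level `0`, and `m j` particles in level `j + 1`. -/
def consConfig (k : ℕ) (m : ℕ →₀ ℕ) : ℕ →₀ ℕ :=
  Finsupp.single 0 k + m.mapDomain Nat.succ

/-- The occupation numbers of the excited levels `1, 2, …`, shifted to start at `0`. -/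
def tailConfig (n : ℕ →₀ ℕ) : ℕ →₀ ℕ :=
  n.comapDomain Nat.succ Nat.succ_injective.injOn

@[simp] lemma consConfig_zero (k : ℕ) (m : ℕ →₀ ℕ) : consConfig k m 0 = k := by
  simp [consConfig, Finsupp.mapDomain_of_notMem_range]

@[simp] lemma consConfig_succ (k : ℕ) (m : ℕ →₀ ℕ) (j : ℕ) : consConfig k m (j + 1) = m j := by
  simpa [consConfig] using Finsupp.mapDomain_apply Nat.succ_injective m j

@[simp] lemma tailConfig_apply (n : ℕ →₀ ℕ) (j : ℕ) : tailConfig n j = n (j + 1) := rfl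

@[simp] lemma tailConfig_consConfig (k : ℕ) (m : ℕ →₀ ℕ) : tailConfig (consConfig k m) = m := by
  ext j; simp

@[simp] lemma consConfig_tailConfig (n : ℕ →₀ ℕ) : consConfig (n 0) (tailConfig n) = n := by
  ext j; cases j <;> simp

/-- Splitting off the occupation number of the ground state. -/
def configEquiv : (ℕ →₀ ℕ) ≃ ℕ × (ℕ →₀ ℕ) where
  toFun n := (n 0, tailConfig n)
  invFun p := consConfig p.1 p.2
  left_inv := consConfig_tailConfig
  right_inv p := by simp

lemma particleNumber_consConfig (k : ℕ) (m : ℕ →₀ ℕ) :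
    particleNumber (consConfig k m) = k + particleNumber m := by
  unfold particleNumber consConfig
  rw [Finsupp.sum_add_index' (by simp) (by simp), Finsupp.sum_single_index rfl,
    Finsupp.sum_mapDomain_index (by simp) (by simp)]

lemma energy_consConfig (ε : ℕ → ℝ) (k : ℕ) (m : ℕ →₀ ℕ) :
    energy ε (consConfig k m) = k * ε 0 + energy (fun j => ε (j + 1)) m := by
  unfold energy consConfig
  rw [Finsupp.sum_add_index' (by simp) (by intros; push_cast; ring),
    Finsupp.sum_single_index (by simp),
    Finsupp.sum_mapDomain_index (by simp) (by intros; push_cast; ring)]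

lemma energy_sub_const (ε : ℕ → ℝ) (c : ℝ) (m : ℕ →₀ ℕ) :
    energy (fun j => ε j - c) m = energy ε m - c * particleNumber m := by
  simp only [energy, particleNumber, Finsupp.sum, mul_sub, Finset.sum_sub_distrib, Nat.cast_sum,
    Finset.sum_mul, mul_comm c]

lemma particleNumber_eq_zero {n : ℕ →₀ ℕ} : particleNumber n = 0 ↔ n = 0 := by
  simp [particleNumber, Finsupp.sum, Finsupp.ext_iff]

lemma particleNumber_eq (n : ℕ →₀ ℕ) : particleNumber n = n 0 + particleNumber (tailConfig n) := by
  conv_lhs => rw [← consConfig_tailConfig n]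
  exact particleNumber_consConfig _ _

/-- Configurations with `N` particles correspond to configurations of at most `N` particles in
the excited levels. -/
def fixedNumberEquiv (N : ℕ) :
    {n : ℕ →₀ ℕ // particleNumber n = N} ≃ {m : ℕ →₀ ℕ // particleNumber m ≤ N} where
  toFun n := ⟨tailConfig n, by have := particleNumber_eq n.1; have := n.2; omega⟩
  invFun m := ⟨consConfig (N - particleNumber m.1) m, by
    rw [particleNumber_consConfig]; have := m.2; omega⟩
  left_inv n := by
    have h : N - particleNumber (tailConfig n.1) = n.1 0 := by
      have := particleNumber_eq n.1; have := n.2; omega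
    ext1
    simp [h]
  right_inv m := by simp

lemma support_consConfig_subset (k n : ℕ) (m : ℕ →₀ ℕ) :
    (consConfig k m).support ⊆ Finset.range (n + 1) ↔ m.support ⊆ Finset.range n := by
  simp only [Finset.subset_iff, Finsupp.mem_support_iff, Finset.mem_range]
  refine ⟨fun h j hj => ?_, fun h j hj => ?_⟩
  · simpa using h (x := j + 1) (by simpa using hj)
  · cases j with
    | zero => omega
    | succ j => simpa using h (x := j) (by simpa using hj)

/-- The grand canonical partition function of finitely many levels. -/
lemma hasSum_indicator_support_subset_range (β : ℝ) (n : ℕ) (e : ℕ → ℝ)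
    (he : ∀ j, 0 < β * e j) :
    HasSum ({m : ℕ →₀ ℕ | m.support ⊆ Finset.range n}.indicator
      fun m => Real.exp (-β * energy e m))
      (∏ j ∈ Finset.range n, (1 - Real.exp (-β * e j))⁻¹) := by
  induction n generalizing e with
  | zero =>
    convert hasSum_single (0 : ℕ →₀ ℕ) _ using 1
    · simp [energy]
    · intro m hm
      simp [hm]
  | succ n ih =>
    have hgeom : HasSum (fun k : ℕ => Real.exp (-β * e 0) ^ k) (1 - Real.exp (-β * e 0))⁻¹ :=
      hasSum_geometric_of_lt_one (Real.exp_nonneg _)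
        (Real.exp_lt_one_iff.mpr (by linarith [he 0]))
    have htail := ih (fun j => e (j + 1)) (fun j => he (j + 1))
    have hprod := hgeom.mul htail (hgeom.summable.mul_of_nonneg htail.summable
      (fun k => by positivity)
      (fun m => Set.indicator_nonneg (fun _ _ => Real.exp_nonneg _) m))
    rw [Finset.prod_range_succ', mul_comm, ← configEquiv.symm.hasSum_iff]
    refine (congrArg (HasSum · _) (funext ?_)).mpr hprod
    rintro ⟨k, m⟩
    by_cases hm : m.support ⊆ Finset.range n
    · have hc := (support_consConfig_subset k n m).2 hm
      simp only [Function.comp_apply, configEquiv, Equiv.coe_fn_symm_mk]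
      rw [Set.indicator_of_mem (by exact hc), Set.indicator_of_mem (by exact hm),
        energy_consConfig, ← Real.exp_nat_mul, ← Real.exp_add]
      ring_nf
    · have hc := (support_consConfig_subset k n m).not.2 hm
      simp only [Function.comp_apply, configEquiv, Equiv.coe_fn_symm_mk]
      rw [Set.indicator_of_notMem (by exact hc), Set.indicator_of_notMem (by exact hm), mul_zero]

lemma tendsto_tsum_indicator {α : Type*} {f : α → ℝ} (hf : Summable f) {s : ℕ → Set α}
    (hs : ∀ a, ∀ᶠ n in atTop, a ∈ s n) :
    Tendsto (fun n => ∑' a, (s n).indicator f a) atTop (nhds (∑' a, f a)) := by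
  refine tendsto_tsum_of_dominated_convergence hf.norm (fun a => ?_)
    (Eventually.of_forall fun n a => norm_indicator_le_norm_self f a)
  refine tendsto_const_nhds.congr' ?_
  filter_upwards [hs a] with n hn
  rw [Set.indicator_of_mem hn]

lemma eventually_support_subset_range (m : ℕ →₀ ℕ) :
    ∀ᶠ n in atTop, m.support ⊆ Finset.range n := by
  obtain ⟨k, hk⟩ := m.support.exists_nat_subset_range
  filter_upwards [eventually_ge_atTop k] with n hn
  exact hk.trans (Finset.range_mono hn)

/-- Convergence and positivity of `∏ (1 - x j)` for summable `x j < 1`. -/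
lemma multipliable_one_sub_and_tprod_pos {x : ℕ → ℝ} (hx : Summable x) (hx1 : ∀ j, x j < 1) :
    Multipliable (fun j => 1 - x j) ∧ 0 < ∏' j, (1 - x j) := by
  have hpos : ∀ j, 0 < 1 - x j := fun j => sub_pos.2 (hx1 j)
  have hlog : Summable fun j => Real.log (1 - x j) := by
    simpa [sub_eq_add_neg] using Real.summable_log_one_add_of_summable hx.neg
  refine ⟨Real.multipliable_of_summable_log hpos hlog, ?_⟩
  rw [← Real.rexp_tsum_eq_tprod hpos hlog]
  exact Real.exp_pos _

/-- The grand canonical partition function of infinitely many levels. -/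
lemma hasSum_exp_neg_energy (β : ℝ) (e : ℕ → ℝ) (he : ∀ j, 0 < β * e j)
    (hsum : Summable fun j => Real.exp (-β * e j)) :
    HasSum (fun m => Real.exp (-β * energy e m)) (∏' j, (1 - Real.exp (-β * e j)))⁻¹ := by
  obtain ⟨hmul, hpos⟩ := multipliable_one_sub_and_tprod_pos hsum
    (fun j => Real.exp_lt_one_iff.mpr (by linarith [he j]))
  have hlim : Tendsto (fun n => ∏ j ∈ Finset.range n, (1 - Real.exp (-β * e j))⁻¹) atTop
      (nhds (∏' j, (1 - Real.exp (-β * e j)))⁻¹) := by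
    simpa only [Finset.prod_inv_distrib] using hmul.hasProd.tendsto_prod_nat.inv₀ hpos.ne'
  have hfin := fun n => hasSum_indicator_support_subset_range β n e he
  have hS : Summable fun m => Real.exp (-β * energy e m) := by
    obtain ⟨C, hC⟩ := hlim.bddAbove_range
    refine summable_of_sum_le (c := C) (fun m => Real.exp_nonneg _) fun u => ?_
    obtain ⟨n, hn⟩ := ((Filter.eventually_all_finset u).2
      fun m _ => eventually_support_subset_range m).exists
    calc ∑ m ∈ u, Real.exp (-β * energy e m)
        = ∑ m ∈ u, ({m : ℕ →₀ ℕ | m.support ⊆ Finset.range n}.indicator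
            fun m => Real.exp (-β * energy e m)) m :=
          Finset.sum_congr rfl fun m hm => by rw [Set.indicator_of_mem (by exact hn m hm)]
      _ ≤ _ := sum_le_hasSum u
          (fun m _ => Set.indicator_nonneg (fun _ _ => Real.exp_nonneg _) m) (hfin n)
      _ ≤ C := hC ⟨n, rfl⟩
  have h := tendsto_tsum_indicator hS eventually_support_subset_range
  rw [tendsto_nhds_unique hlim (h.congr fun n => (hfin n).tsum_eq)]
  exact hS.hasSum

lemma Z_eq (ε : ℕ → ℝ) (β : ℝ) (N : ℕ) :
    Z ε β N = Real.exp (-β * N * ε 0) * ∑' m, {m : ℕ →₀ ℕ | particleNumber m ≤ N}.indicator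
      (fun m => Real.exp (-β * energy (fun j => ε (j + 1) - ε 0) m)) m := by
  rw [← tsum_subtype, ← tsum_mul_left, Z, ← (fixedNumberEquiv N).symm.tsum_eq]
  refine tsum_congr fun m => ?_
  have hm : particleNumber m.1 ≤ N := m.2
  simp only [fixedNumberEquiv, Equiv.coe_fn_symm_mk]
  rw [← Real.exp_add, energy_consConfig, energy_sub_const (fun j => ε (j + 1)), Nat.cast_sub hm]
  ring_nf

lemma tsum_all_in_ground_state (ε : ℕ → ℝ) (β : ℝ) (N : ℕ) :
    ∑' n : {n : ℕ →₀ ℕ // particleNumber n = N ∧ n ∈ {n : ℕ →₀ ℕ | N - n 0 = 0}},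
      Real.exp (-β * energy ε n) = Real.exp (-β * N * ε 0) := by
  rw [tsum_eq_single ⟨Finsupp.single 0 N, by simp [particleNumber]⟩]
  · simp [energy, mul_assoc]
  · rintro ⟨n, hn, h0⟩ hne
    refine absurd (Subtype.ext ?_) hne
    change n = Finsupp.single 0 N
    have h0' : N - n 0 = 0 := h0
    have hsplit := particleNumber_eq n
    have ht : tailConfig n = 0 := particleNumber_eq_zero.1 (by omega)
    have hN : n 0 = N := by omega
    rw [← consConfig_tailConfig n, ht, hN]
    simp [consConfig]

/-- For every `β > 0`, the probability that all particles occupy the ground state equals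
`exp (-β N ε 0) / Z_N(β)`, and it converges as `N → ∞` to
`∏_{j=1}^∞ (1 - exp (-β (ε j - ε 0)))`, a strictly positive limit.
Here `N'(n) = N - n 0` is the number of particles in excited states. -/
theorem prob_all_in_ground_state_tendsto (ε : ℕ → ℝ) (hmono : Monotone ε) (hgap : ε 0 < ε 1)
    (htrace : ∀ β : ℝ, 0 < β → Summable fun j => Real.exp (-β * ε j))
    (β : ℝ) (hβ : 0 < β) :
    (∀ N : ℕ, P ε β N {n : ℕ →₀ ℕ | N - n 0 = 0} =
      Real.exp (-β * N * ε 0) / Z ε β N) ∧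
    Tendsto (fun N : ℕ => P ε β N {n : ℕ →₀ ℕ | N - n 0 = 0}) atTop
      (nhds (∏' j : ℕ, (1 - Real.exp (-β * (ε (j + 1) - ε 0))))) ∧
    0 < ∏' j : ℕ, (1 - Real.exp (-β * (ε (j + 1) - ε 0))) := by
  have hP : ∀ N : ℕ, P ε β N {n : ℕ →₀ ℕ | N - n 0 = 0} =
      Real.exp (-β * N * ε 0) / Z ε β N := fun N => by
    rw [P, tsum_all_in_ground_state]
  have he : ∀ j, 0 < β * (ε (j + 1) - ε 0) := fun j =>
    mul_pos hβ (sub_pos.2 (hgap.trans_le (hmono (by omega))))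
  have hsum : Summable fun j => Real.exp (-β * (ε (j + 1) - ε 0)) := by
    refine (((summable_nat_add_iff 1).2 (htrace β hβ)).mul_right (Real.exp (β * ε 0))).congr
      fun j => ?_
    rw [← Real.exp_add]
    ring_nf
  have hpos := (multipliable_one_sub_and_tprod_pos hsum
    (fun j => Real.exp_lt_one_iff.mpr (by linarith [he j]))).2
  refine ⟨hP, ?_, hpos⟩
  have hgrand := hasSum_exp_neg_energy β (fun j => ε (j + 1) - ε 0) he hsum
  have hlim := (tendsto_tsum_indicator hgrand.summable
    (s := fun N => {m : ℕ →₀ ℕ | particleNumber m ≤ N})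
    (fun m => eventually_ge_atTop (particleNumber m))).inv₀
    (by rw [hgrand.tsum_eq]; exact inv_ne_zero hpos.ne')
  rw [hgrand.tsum_eq, inv_inv] at hlim
  refine hlim.congr fun N => ?_
  rw [hP, Z_eq, div_mul_cancel_left₀ (Real.exp_ne_zero _)]
end
end

section
/- Let β > 0 and let a : ℕ → ℕ be a sequence with 0 < a N ≤ N for all N ≥ 1 and a N → ∞. Then lim_{N→∞} (1/(a N)) · log P_N({n : N'(n) ≥ a N}) = −β(ε 1 − ε 0). -/
open scoped BigOperators
open Filter

noncomputable section

/-- Finite partial sums of the grand canonical weights factor over the one-particle levels. -/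
theorem sum_finsupp_prod_pow_le {x : ℕ → ℝ} (h0 : ∀ j, 0 ≤ x j) (h1 : ∀ j, x j < 1)
    (K : ℕ) (F : Finset (ℕ →₀ ℕ)) (hF : ∀ n ∈ F, n.support ⊆ Finset.range K) :
    ∑ n ∈ F, (n.prod fun j k => x j ^ k) ≤ ∏ j ∈ Finset.range K, (1 - x j)⁻¹ := by
  classical
  have hW : ∀ n : ℕ →₀ ℕ, 0 ≤ n.prod fun j k => x j ^ k := fun n =>
    Finset.prod_nonneg fun j _ => pow_nonneg (h0 j) _
  induction K generalizing F with
  | zero =>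
    have hsub : F ⊆ {0} := fun n hn => by simpa using hF n hn
    refine (Finset.sum_le_sum_of_subset_of_nonneg hsub fun n _ _ => hW n).trans ?_
    simp
  | succ K ih =>
    let g : (ℕ →₀ ℕ) → ℕ × (ℕ →₀ ℕ) := fun n => (n K, n.erase K)
    have hg : Function.Injective g := fun m n h => by
      rw [Prod.mk.injEq] at h
      rw [← Finsupp.single_add_erase K m, ← Finsupp.single_add_erase K n, h.1, h.2]
    have hgeom : ∑ k ∈ F.image (fun n => n K), x K ^ k ≤ (1 - x K)⁻¹ := by
      rw [← tsum_geometric_of_lt_one (h0 K) (h1 K)]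
      exact (summable_geometric_of_lt_one (h0 K) (h1 K)).sum_le_tsum _
        fun k _ => pow_nonneg (h0 K) k
    have herase : ∑ m ∈ F.image (fun n => n.erase K), (m.prod fun j k => x j ^ k) ≤
        ∏ j ∈ Finset.range K, (1 - x j)⁻¹ := by
      refine ih _ fun m hm => ?_
      obtain ⟨n, hn, rfl⟩ := Finset.mem_image.1 hm
      intro j hj
      rw [Finsupp.support_erase, Finset.mem_erase] at hj
      have := Finset.mem_range.1 (hF n hn hj.2)
      exact Finset.mem_range.2 (by omega)
    calc ∑ n ∈ F, (n.prod fun j k => x j ^ k)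
        = ∑ q ∈ F.image g, x K ^ q.1 * (q.2.prod fun j k => x j ^ k) := by
          rw [Finset.sum_image fun m _ n _ h => hg h]
          exact Finset.sum_congr rfl fun n _ =>
            (Finsupp.mul_prod_erase' n K _ fun j => pow_zero (x j)).symm
      _ ≤ ∑ q ∈ F.image (fun n => n K) ×ˢ F.image (fun n => n.erase K),
            x K ^ q.1 * (q.2.prod fun j k => x j ^ k) := by
          refine Finset.sum_le_sum_of_subset_of_nonneg ?_ fun q _ _ =>
            mul_nonneg (pow_nonneg (h0 K) _) (hW _)
          intro q hq
          obtain ⟨n, hn, rfl⟩ := Finset.mem_image.1 hq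
          exact Finset.mem_product.2
            ⟨Finset.mem_image_of_mem (fun n : ℕ →₀ ℕ => n K) hn,
              Finset.mem_image_of_mem (fun n : ℕ →₀ ℕ => n.erase K) hn⟩
      _ = (∑ k ∈ F.image (fun n => n K), x K ^ k) *
            ∑ m ∈ F.image (fun n => n.erase K), (m.prod fun j k => x j ^ k) := by
          rw [Finset.sum_mul_sum, Finset.sum_product]
      _ ≤ (1 - x K)⁻¹ * ∏ j ∈ Finset.range K, (1 - x j)⁻¹ :=
          mul_le_mul hgeom herase (Finset.sum_nonneg fun m _ => hW m)
            (inv_nonneg.2 (sub_nonneg.2 (h1 K).le))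
      _ = ∏ j ∈ Finset.range (K + 1), (1 - x j)⁻¹ := by
          rw [Finset.prod_range_succ, mul_comm]

theorem summable_finsupp_prod_pow {x : ℕ → ℝ} {r : ℝ} (h0 : ∀ j, 0 ≤ x j) (hr : r < 1)
    (hxr : ∀ j, x j ≤ r) (hx : Summable x) :
    Summable fun n : ℕ →₀ ℕ => n.prod fun j k => x j ^ k := by
  have hr' : 0 < 1 - r := sub_pos.2 hr
  refine summable_of_sum_le (c := Real.exp ((1 - r)⁻¹ * ∑' j, x j))
    (fun n => Finset.prod_nonneg fun j _ => pow_nonneg (h0 j) _) fun F => ?_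
  obtain ⟨K, hK⟩ := (F.biUnion Finsupp.support).exists_nat_subset_range
  refine (sum_finsupp_prod_pow_le h0 (fun j => (hxr j).trans_lt hr) K F fun n hn =>
    (Finset.subset_biUnion_of_mem _ hn).trans hK).trans ?_
  calc ∏ j ∈ Finset.range K, (1 - x j)⁻¹
      ≤ ∏ j ∈ Finset.range K, (1 + (1 - r)⁻¹ * x j) := by
        refine Finset.prod_le_prod (fun j _ => inv_nonneg.2 (by linarith [hxr j])) fun j _ => ?_
        have hj : 0 < 1 - x j := by linarith [hxr j]
        have hle : (1 - x j)⁻¹ ≤ (1 - r)⁻¹ := inv_anti₀ hr' (by linarith [hxr j])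
        have heq : (1 - x j)⁻¹ = 1 + (1 - x j)⁻¹ * x j := by field_simp; ring
        rw [heq]
        gcongr
        exact h0 j
    _ ≤ Real.exp (∑ j ∈ Finset.range K, (1 - r)⁻¹ * x j) :=
        Real.prod_one_add_le_exp_sum _ fun j => mul_nonneg (inv_nonneg.2 hr'.le) (h0 j)
    _ ≤ Real.exp ((1 - r)⁻¹ * ∑' j, x j) := by
        rw [← Finset.mul_sum]
        gcongr
        exact hx.sum_le_tsum _ fun j _ => h0 j

/-- The grand canonical partition function converges when the levels are bounded below by a
positive constant and the one-particle partition function converges. -/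
theorem summable_exp_neg_energy {c : ℕ → ℝ} {δ : ℝ} (hδ : 0 < δ) (hc : ∀ j, δ ≤ c j)
    (hs : Summable fun j => Real.exp (-c j)) :
    Summable fun n : ℕ →₀ ℕ => Real.exp (-energy c n) := by
  refine (summable_finsupp_prod_pow (fun j => (Real.exp_pos _).le)
    (Real.exp_lt_one_iff.2 (neg_lt_zero.2 hδ))
    (fun j => Real.exp_le_exp.2 (neg_le_neg (hc j))) hs).congr fun n => ?_
  rw [energy, Finsupp.sum, ← Finset.sum_neg_distrib, Real.exp_sum, Finsupp.prod]
  exact Finset.prod_congr rfl fun j _ => by rw [← Real.exp_nat_mul, mul_neg]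

theorem particleNumber_eq_add_erase (n : ℕ →₀ ℕ) (j : ℕ) :
    particleNumber n = n j + particleNumber (n.erase j) :=
  (Finsupp.add_sum_erase' n j _ fun _ => rfl).symm

theorem energy_eq_add_erase (ε : ℕ → ℝ) (n : ℕ →₀ ℕ) (j : ℕ) :
    energy ε n = n j * ε j + energy ε (n.erase j) :=
  (Finsupp.add_sum_erase' n j _ fun _ => by simp).symm

/-- The levels measured from the ground state, in units of temperature and shifted by `-s`, with
an arbitrary positive value at the ground state. -/
def excitedLevels (ε : ℕ → ℝ) (β s : ℝ) (j : ℕ) : ℝ :=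
  if j = 0 then 1 else β * (ε j - ε 0) - s

theorem energy_excitedLevels_erase (ε : ℕ → ℝ) (β s : ℝ) (n : ℕ →₀ ℕ) :
    energy (excitedLevels ε β s) (n.erase 0) =
      β * energy ε (n.erase 0) - (β * ε 0 + s) * particleNumber (n.erase 0) := by
  simp only [energy, particleNumber, Finsupp.sum, Nat.cast_sum, Finset.mul_sum]
  rw [← Finset.sum_sub_distrib]
  refine Finset.sum_congr rfl fun j hj => ?_
  have hj0 : j ≠ 0 := by
    rw [Finsupp.support_erase] at hj
    exact Finset.ne_of_mem_erase hj
  rw [excitedLevels, if_neg hj0]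
  ring

theorem summable_exp_neg_energy_excitedLevels {ε : ℕ → ℝ} (hmono : Monotone ε) {β s : ℝ}
    (hβ : 0 < β) (htrace : Summable fun j => Real.exp (-β * ε j)) (hs : s < β * (ε 1 - ε 0)) :
    Summable fun n : ℕ →₀ ℕ => Real.exp (-energy (excitedLevels ε β s) n) := by
  refine summable_exp_neg_energy (δ := min 1 (β * (ε 1 - ε 0) - s))
    (lt_min one_pos (sub_pos.2 hs)) (fun j => ?_) ?_
  · rcases Nat.eq_zero_or_pos j with rfl | hj
    · simp [excitedLevels]
    · rw [excitedLevels, if_neg hj.ne']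
      refine (min_le_right _ _).trans ?_
      have := hmono (Nat.succ_le_of_lt hj)
      gcongr
  · rw [← summable_nat_add_iff 1]
    refine (((summable_nat_add_iff 1).2 htrace).mul_left (Real.exp (β * ε 0 + s))).congr
      fun j => ?_
    rw [excitedLevels, if_neg j.succ_ne_zero, ← Real.exp_add]
    ring_nf

/-- Chernoff bound for the number of excited particles. -/
theorem tsum_exp_neg_energy_le {ε : ℕ → ℝ} (hmono : Monotone ε) {β s : ℝ} (hβ : 0 < β)
    (htrace : Summable fun j => Real.exp (-β * ε j)) (hs0 : 0 ≤ s) (hs : s < β * (ε 1 - ε 0))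
    {N A : ℕ} {p : (ℕ →₀ ℕ) → Prop} (hp : ∀ n, p n → particleNumber n = N ∧ A ≤ N - n 0) :
    Summable (fun n : {n // p n} => Real.exp (-β * energy ε n)) ∧
      ∑' n : {n // p n}, Real.exp (-β * energy ε n) ≤
        Real.exp (-β * (N * ε 0)) * Real.exp (-s * A) *
          ∑' m, Real.exp (-energy (excitedLevels ε β s) m) := by
  have hsum := summable_exp_neg_energy_excitedLevels hmono hβ htrace hs
  have hinj : Function.Injective fun n : {n // p n} => (n : ℕ →₀ ℕ).erase 0 := by
    rintro ⟨m, hm⟩ ⟨n, hn⟩ (h : m.erase 0 = n.erase 0)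
    have hm' := (hp m hm).1
    have hn' := (hp n hn).1
    rw [particleNumber_eq_add_erase _ 0] at hm' hn'
    rw [h] at hm'
    rw [Subtype.mk.injEq, ← Finsupp.single_add_erase 0 m, ← Finsupp.single_add_erase 0 n, h,
      show m 0 = n 0 by omega]
  have hle : ∀ n : {n // p n}, Real.exp (-β * energy ε n) ≤
      Real.exp (-β * (N * ε 0)) * Real.exp (-s * A) *
        Real.exp (-energy (excitedLevels ε β s) ((n : ℕ →₀ ℕ).erase 0)) := by
    rintro ⟨n, hn⟩
    obtain ⟨hN, hA⟩ := hp n hn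
    rw [particleNumber_eq_add_erase n 0] at hN
    have hA' : (A : ℝ) ≤ particleNumber (n.erase 0) := by exact_mod_cast (by omega)
    have hN' : (N : ℝ) = n 0 + particleNumber (n.erase 0) := by exact_mod_cast hN.symm
    rw [← Real.exp_add, ← Real.exp_add, Real.exp_le_exp, energy_excitedLevels_erase,
      energy_eq_add_erase ε n 0, hN']
    linarith [mul_le_mul_of_nonneg_left hA' hs0]
  have hsum' := (hsum.comp_injective hinj).mul_left
    (Real.exp (-β * (N * ε 0)) * Real.exp (-s * A))
  have hsumm := Summable.of_nonneg_of_le (fun _ => (Real.exp_pos _).le) hle hsum'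
  refine ⟨hsumm, (hsumm.tsum_le_tsum hle hsum').trans ?_⟩
  rw [tsum_mul_left]
  gcongr
  exact tsum_comp_le_tsum_of_inj hsum (fun _ => (Real.exp_pos _).le) hinj

theorem exp_le_Z {ε : ℕ → ℝ} (hmono : Monotone ε) (hgap : ε 0 < ε 1) {β : ℝ} (hβ : 0 < β)
    (htrace : Summable fun j => Real.exp (-β * ε j)) (N : ℕ) :
    Real.exp (-β * (N * ε 0)) ≤ Z ε β N := by
  have hsum := (tsum_exp_neg_energy_le hmono hβ htrace le_rfl
    (mul_pos hβ (sub_pos.2 hgap)) (N := N) (A := 0)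
    (p := fun n => particleNumber n = N) fun n hn => ⟨hn, Nat.zero_le _⟩).1
  have := hsum.le_tsum ⟨Finsupp.single 0 N, by simp [particleNumber]⟩
    fun _ _ => (Real.exp_pos _).le
  simpa [Z, energy] using this

/-- Exponential upper bound on the number of excited particles, at every rate below
`β * (ε 1 - ε 0)`. -/
theorem P_le {ε : ℕ → ℝ} (hmono : Monotone ε) (hgap : ε 0 < ε 1) {β s : ℝ} (hβ : 0 < β)
    (htrace : Summable fun j => Real.exp (-β * ε j)) (hs0 : 0 ≤ s) (hs : s < β * (ε 1 - ε 0))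
    (N A : ℕ) :
    P ε β N {n : ℕ →₀ ℕ | A ≤ N - n 0} ≤
      Real.exp (-s * A) * ∑' m, Real.exp (-energy (excitedLevels ε β s) m) := by
  have hZ := exp_le_Z hmono hgap hβ htrace N
  rw [P, div_le_iff₀ ((Real.exp_pos _).trans_le hZ)]
  refine (tsum_exp_neg_energy_le hmono hβ htrace hs0 hs (N := N) (A := A)
    fun n hn => hn).2.trans ?_
  have hC : 0 ≤ ∑' m, Real.exp (-energy (excitedLevels ε β s) m) :=
    tsum_nonneg fun _ => (Real.exp_pos _).le
  rw [mul_assoc, mul_comm]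
  gcongr

/-- Exponential lower bound on the number of excited particles, from the configuration with
exactly `A` of them, all in the first excited level. -/
theorem le_P {ε : ℕ → ℝ} (hmono : Monotone ε) (hgap : ε 0 < ε 1) {β : ℝ} (hβ : 0 < β)
    (htrace : Summable fun j => Real.exp (-β * ε j)) {N A : ℕ} (hA : A ≤ N) :
    Real.exp (-(β * (ε 1 - ε 0)) * A) /
        ∑' m, Real.exp (-energy (excitedLevels ε β 0) m) ≤
      P ε β N {n : ℕ →₀ ℕ | A ≤ N - n 0} := by
  have hpos := mul_pos hβ (sub_pos.2 hgap)
  have hZ0 := (Real.exp_pos _).trans_le (exp_le_Z hmono hgap hβ htrace N)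
  have hZ : Z ε β N ≤ Real.exp (-β * (N * ε 0)) *
      ∑' m, Real.exp (-energy (excitedLevels ε β 0) m) := by
    simpa [Z] using (tsum_exp_neg_energy_le hmono hβ htrace le_rfl hpos (N := N) (A := 0)
      (p := fun n => particleNumber n = N) fun n hn => ⟨hn, Nat.zero_le _⟩).2
  have hC : 0 < ∑' m, Real.exp (-energy (excitedLevels ε β 0) m) :=
    (summable_exp_neg_energy_excitedLevels hmono hβ htrace hpos).tsum_pos
      (fun _ => (Real.exp_pos _).le) 0 (Real.exp_pos _)
  have hsum := (tsum_exp_neg_energy_le hmono hβ htrace le_rfl hpos (N := N) (A := A)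
    (p := fun n => particleNumber n = N ∧ n ∈ {n : ℕ →₀ ℕ | A ≤ N - n 0}) fun n hn => hn).1
  let n₀ : ℕ →₀ ℕ := Finsupp.single 0 (N - A) + Finsupp.single 1 A
  have herase : n₀.erase 0 = Finsupp.single 1 A := by
    rw [Finsupp.erase_add, Finsupp.erase_single, Finsupp.erase_single_ne zero_ne_one, zero_add]
  have hzero : n₀ 0 = N - A := by simp [n₀]
  have hnum : particleNumber n₀ = N := by
    rw [particleNumber_eq_add_erase n₀ 0, herase, hzero]
    simp [particleNumber, hA]
  have hen : energy ε n₀ = N * ε 0 + A * (ε 1 - ε 0) := by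
    rw [energy_eq_add_erase ε n₀ 0, herase, hzero, Nat.cast_sub hA]
    simp [energy]
    ring
  have hone := hsum.le_tsum ⟨n₀, hnum, by change A ≤ N - n₀ 0; omega⟩
    fun _ _ => (Real.exp_pos _).le
  rw [P, div_le_div_iff₀ hC hZ0]
  calc Real.exp (-(β * (ε 1 - ε 0)) * A) * Z ε β N
      ≤ Real.exp (-(β * (ε 1 - ε 0)) * A) * (Real.exp (-β * (N * ε 0)) *
          ∑' m, Real.exp (-energy (excitedLevels ε β 0) m)) := by gcongr
    _ = Real.exp (-β * energy ε n₀) *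
          ∑' m, Real.exp (-energy (excitedLevels ε β 0) m) := by
        rw [← mul_assoc, ← Real.exp_add, hen]
        ring_nf
    _ ≤ _ := by gcongr

/-- Let `β > 0` and let `a : ℕ → ℕ` satisfy `0 < a N ≤ N` for all `N ≥ 1` and `a N → ∞`.
Then `(1 / a N) * log P_N(N' ≥ a N) → -β (ε 1 - ε 0)` as `N → ∞`,
where `N'(n) = N - n 0` is the number of particles in excited states. -/
theorem large_deviation_excited_particles (ε : ℕ → ℝ) (hmono : Monotone ε) (hgap : ε 0 < ε 1)
    (htrace : ∀ β : ℝ, 0 < β → Summable fun j => Real.exp (-β * ε j))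
    (β : ℝ) (hβ : 0 < β) (a : ℕ → ℕ)
    (ha : ∀ N : ℕ, 1 ≤ N → 0 < a N ∧ a N ≤ N)
    (hatop : Tendsto a atTop atTop) :
    Tendsto (fun N : ℕ =>
        (1 / (a N : ℝ)) * Real.log (P ε β N {n : ℕ →₀ ℕ | a N ≤ N - n 0}))
      atTop (nhds (-β * (ε 1 - ε 0))) := by
  have hpos := mul_pos hβ (sub_pos.2 hgap)
  have hC : ∀ s, s < β * (ε 1 - ε 0) →
      0 < ∑' m, Real.exp (-energy (excitedLevels ε β s) m) := fun s hs =>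
    (summable_exp_neg_energy_excitedLevels hmono hβ (htrace β hβ) hs).tsum_pos
      (fun _ => (Real.exp_pos _).le) 0 (Real.exp_pos _)
  have hdiv : ∀ x : ℝ, Tendsto (fun N => x / (a N : ℝ)) atTop (nhds 0) := fun x =>
    (tendsto_const_div_atTop_nhds_zero_nat x).comp hatop
  have hP0 : ∀ N, 1 ≤ N → 0 < P ε β N {n : ℕ →₀ ℕ | a N ≤ N - n 0} := fun N hN =>
    (div_pos (Real.exp_pos _) (hC 0 hpos)).trans_le
      (le_P hmono hgap hβ (htrace β hβ) (ha N hN).2)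
  rw [tendsto_order]
  constructor
  · intro y hy
    set C := ∑' m, Real.exp (-energy (excitedLevels ε β 0) m) with hCdef
    have hev : ∀ᶠ N in atTop, Real.log C / (a N : ℝ) < -β * (ε 1 - ε 0) - y :=
      (hdiv _).eventually_lt_const (sub_pos.2 hy)
    filter_upwards [hev, eventually_ge_atTop 1] with N hN hN1
    have haN : (0 : ℝ) < a N := by exact_mod_cast (ha N hN1).1
    have hlog := Real.log_le_log (div_pos (Real.exp_pos _) (hC 0 hpos))
      (le_P hmono hgap hβ (htrace β hβ) (ha N hN1).2)
    rw [Real.log_div (Real.exp_pos _).ne' (hC 0 hpos).ne', Real.log_exp, ← hCdef] at hlog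
    rw [div_lt_iff₀ haN] at hN
    rw [one_div, ← div_eq_inv_mul, lt_div_iff₀ haN]
    linarith
  · intro y hy
    obtain ⟨s, hs1, hs2⟩ := exists_between
      (max_lt hpos (show -y < β * (ε 1 - ε 0) by linarith))
    have hs0 : 0 ≤ s := ((le_max_left _ _).trans_lt hs1).le
    have hsy : -y < s := (le_max_right _ _).trans_lt hs1
    set C := ∑' m, Real.exp (-energy (excitedLevels ε β s) m) with hCdef
    have hev : ∀ᶠ N in atTop, Real.log C / (a N : ℝ) < y + s :=
      (hdiv _).eventually_lt_const (by linarith)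
    filter_upwards [hev, eventually_ge_atTop 1] with N hN hN1
    have haN : (0 : ℝ) < a N := by exact_mod_cast (ha N hN1).1
    have hlog := Real.log_le_log (hP0 N hN1)
      (P_le hmono hgap hβ (htrace β hβ) hs0 hs2 N (a N))
    rw [Real.log_mul (Real.exp_pos _).ne' (hC s hs2).ne', Real.log_exp, ← hCdef] at hlog
    rw [div_lt_iff₀ haN] at hN
    rw [one_div, ← div_eq_inv_mul, div_lt_iff₀ haN]
    linarith
end
end

section
/- For every β > 0 there is a constant c(β) > 0 such that for all N ∈ ℕ and all indices i, j ≥ 1 with i ≠ j, the canonical Gibbs expectations satisfy ⟨n i · (n i − 1)⟩_N ≤ c(β) · exp(−2β(ε i − ε 0)) and ⟨(n i)(n j)⟩_N ≤ c(β) · exp(−β(ε i − ε 0)) · exp(−β(ε j − ε 0)). -/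
open scoped BigOperators

noncomputable section

/-- The canonical expectation of `f` among configurations with particle number `N`. -/
def expect (ε : ℕ → ℝ) (β : ℝ) (N : ℕ) (f : (ℕ →₀ ℕ) → ℝ) : ℝ :=
  (∑' n : {n : ℕ →₀ ℕ // particleNumber n = N},
      f n * Real.exp (-β * energy ε n)) / Z ε β N

theorem particleNumber_add (m n : ℕ →₀ ℕ) :
    particleNumber (m + n) = particleNumber m + particleNumber n :=
  Finsupp.sum_add_index' (fun _ => rfl) fun _ _ _ => rfl

theorem particleNumber_single (i k : ℕ) : particleNumber (Finsupp.single i k) = k :=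
  Finsupp.sum_single_index rfl

theorem energy_add (ε : ℕ → ℝ) (m n : ℕ →₀ ℕ) :
    energy ε (m + n) = energy ε m + energy ε n :=
  Finsupp.sum_add_index' (by simp) fun _ _ _ => by push_cast; ring

theorem energy_single (ε : ℕ → ℝ) (i k : ℕ) : energy ε (Finsupp.single i k) = k * ε i :=
  Finsupp.sum_single_index (by simp)

theorem apply_le_particleNumber (n : ℕ →₀ ℕ) (i : ℕ) : n i ≤ particleNumber n := by
  have h := particleNumber_add (n - Finsupp.single i (n i)) (Finsupp.single i (n i))
  rw [tsub_add_cancel_of_le (by simp), particleNumber_single] at h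
  omega

/-- Move the particles of the configuration `m` inside `n` to the level `0`. -/
def condense (m n : ℕ →₀ ℕ) : ℕ →₀ ℕ := n - m + Finsupp.single 0 (particleNumber m)

theorem condense_add {m n : ℕ →₀ ℕ} (h : m ≤ n) :
    condense m n + m = n + Finsupp.single 0 (particleNumber m) := by
  rw [condense, add_right_comm, tsub_add_cancel_of_le h]

theorem particleNumber_condense {m n : ℕ →₀ ℕ} (h : m ≤ n) :
    particleNumber (condense m n) = particleNumber n := by
  have := congrArg particleNumber (condense_add h)
  rw [particleNumber_add, particleNumber_add, particleNumber_single] at this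
  omega

theorem energy_condense (ε : ℕ → ℝ) {m n : ℕ →₀ ℕ} (h : m ≤ n) :
    energy ε (condense m n) = energy ε n - (energy ε m - particleNumber m * ε 0) := by
  have := congrArg (energy ε) (condense_add h)
  rw [energy_add, energy_add, energy_single] at this
  linarith

theorem condense_injOn (m : ℕ →₀ ℕ) : Set.InjOn (condense m) {n | m ≤ n} := by
  intro n hn n' hn' h
  have h' := condense_add (show m ≤ n from hn)
  rw [h, condense_add (show m ≤ n' from hn')] at h'
  exact (add_right_cancel h').symm

theorem tsum_indicator_weight_le (ε : ℕ → ℝ) (β : ℝ) (N : ℕ) (m : ℕ →₀ ℕ)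
    (hs : Summable fun n : {n : ℕ →₀ ℕ // particleNumber n = N} => Real.exp (-β * energy ε n)) :
    ∑' n : {n : ℕ →₀ ℕ // particleNumber n = N},
      {n : {n : ℕ →₀ ℕ // particleNumber n = N} | m ≤ n}.indicator
        (fun n => Real.exp (-β * energy ε n)) n ≤
      Real.exp (-β * (energy ε m - particleNumber m * ε 0)) * Z ε β N := by
  set s : Set {n : ℕ →₀ ℕ // particleNumber n = N} := {n | m ≤ n}
  let T : s → {n : ℕ →₀ ℕ // particleNumber n = N} := fun x =>
    ⟨condense m x.1, (particleNumber_condense x.2).trans x.1.2⟩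
  have hT : Function.Injective T := fun x y h =>
    Subtype.ext <| Subtype.ext <| condense_injOn m x.2 y.2 (congrArg Subtype.val h)
  rw [← tsum_subtype]
  have hw : ∀ x : s, Real.exp (-β * energy ε x.1) =
      Real.exp (-β * (energy ε m - particleNumber m * ε 0)) *
        Real.exp (-β * energy ε (T x)) := fun x => by
    rw [← Real.exp_add, show energy ε (T x) = _ from energy_condense ε x.2]
    congr 1
    ring
  rw [tsum_congr hw, tsum_mul_left]
  exact mul_le_mul_of_nonneg_left
    (tsum_comp_le_tsum_of_inj hs (fun _ => (Real.exp_pos _).le) hT) (Real.exp_pos _).le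

/-- An observable that is a nonnegative combination of indicators of the events `m a ≤ n` has
expectation at most the same combination of the Boltzmann factors for exciting `m a`. -/
theorem expect_le_of_eq_sum {ι : Type*} (ε : ℕ → ℝ) (β : ℝ) (N : ℕ) (f : (ℕ →₀ ℕ) → ℝ)
    (t : Finset ι) (c : ι → ℝ) (m : ι → ℕ →₀ ℕ) (hc : ∀ a, 0 ≤ c a)
    (hf : ∀ n, particleNumber n = N → f n = ∑ a ∈ t, c a * if m a ≤ n then 1 else 0) :
    expect ε β N f ≤
      ∑ a ∈ t, c a * Real.exp (-β * (energy ε (m a) - particleNumber (m a) * ε 0)) := by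
  have hZ0 : 0 ≤ Z ε β N := tsum_nonneg fun _ => (Real.exp_pos _).le
  have hR : 0 ≤
      ∑ a ∈ t, c a * Real.exp (-β * (energy ε (m a) - particleNumber (m a) * ε 0)) :=
    Finset.sum_nonneg fun a _ => mul_nonneg (hc a) (Real.exp_pos _).le
  by_cases hs : Summable fun n : {n : ℕ →₀ ℕ // particleNumber n = N} =>
      Real.exp (-β * energy ε n)
  · refine div_le_of_le_mul₀ hZ0 hR ?_
    have hterm : ∀ n : {n : ℕ →₀ ℕ // particleNumber n = N},
        f n * Real.exp (-β * energy ε n) =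
          ∑ a ∈ t, c a * {n : {n : ℕ →₀ ℕ // particleNumber n = N} | m a ≤ n}.indicator
            (fun n => Real.exp (-β * energy ε n)) n := fun n => by
      rw [hf n n.2, Finset.sum_mul]
      refine Finset.sum_congr rfl fun a _ => ?_
      by_cases h : m a ≤ n <;> simp [h]
    rw [tsum_congr hterm, Summable.tsum_finsetSum fun a _ => (hs.indicator _).mul_left _,
      Finset.sum_mul]
    refine Finset.sum_le_sum fun a _ => ?_
    rw [tsum_mul_left, mul_assoc]
    exact mul_le_mul_of_nonneg_left (tsum_indicator_weight_le ε β N (m a) hs) (hc a)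
  · rwa [expect, Z, tsum_eq_zero_of_not_summable hs, div_zero]

theorem sum_range_ite_lt (N k : ℕ) (hk : k ≤ N) (g : ℕ → ℝ) :
    ∑ a ∈ Finset.range N, g a * (if a + 1 ≤ k then 1 else 0) = ∑ a ∈ Finset.range k, g a := by
  simp only [mul_ite, mul_one, mul_zero, ← Finset.sum_filter]
  congr 1
  ext a
  simp only [Finset.mem_filter, Finset.mem_range]
  omega

theorem sum_range_two_mul (k : ℕ) :
    ∑ a ∈ Finset.range k, 2 * (a : ℝ) = (k : ℝ) * ((k : ℝ) - 1) := by
  induction k with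
  | zero => simp
  | succ k ih => rw [Finset.sum_range_succ, ih]; push_cast; ring

theorem sum_range_pow_succ_le {x q : ℝ} (hx : 0 ≤ x) (hxq : x ≤ q) (hq : q < 1) (N : ℕ) :
    ∑ a ∈ Finset.range N, x ^ (a + 1) ≤ x * (1 - q)⁻¹ := by
  have h := (summable_geometric_of_lt_one hx (hxq.trans_lt hq)).sum_le_tsum (Finset.range N)
    fun a _ => pow_nonneg hx a
  rw [tsum_geometric_of_lt_one hx (hxq.trans_lt hq)] at h
  simp only [pow_succ', ← Finset.mul_sum]
  have : 0 < 1 - q := by linarith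
  exact mul_le_mul_of_nonneg_left (h.trans (by gcongr)) hx

theorem sum_range_two_mul_pow_succ_le {x q : ℝ} (hx : 0 ≤ x) (hxq : x ≤ q) (hq : q < 1) (N : ℕ) :
    ∑ a ∈ Finset.range N, 2 * (a : ℝ) * x ^ (a + 1) ≤ 2 / (1 - q) ^ 2 * x ^ 2 := by
  have hx1 : ‖x‖ < 1 := by rw [Real.norm_of_nonneg hx]; exact hxq.trans_lt hq
  have h := sum_le_hasSum (Finset.range N) (fun a _ => by positivity)
    (hasSum_coe_mul_geometric_of_norm_lt_one hx1)
  have h1 : 0 < 1 - q := by linarith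
  calc ∑ a ∈ Finset.range N, 2 * (a : ℝ) * x ^ (a + 1)
      = 2 * x * ∑ a ∈ Finset.range N, (a : ℝ) * x ^ a := by
        rw [Finset.mul_sum]
        exact Finset.sum_congr rfl fun a _ => by ring
    _ ≤ 2 * x * (x / (1 - x) ^ 2) := by gcongr
    _ ≤ 2 * x * (x / (1 - q) ^ 2) := by gcongr
    _ = 2 / (1 - q) ^ 2 * x ^ 2 := by ring

/-- For every `β > 0` there is `c(β) > 0` such that for all `N` and all `i ≠ j` with
`i, j ≥ 1`, the canonical Gibbs expectations satisfy
`⟨n i (n i - 1)⟩_N ≤ c(β) exp (-2β (ε i - ε 0))` and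
`⟨n i * n j⟩_N ≤ c(β) exp (-β (ε i - ε 0)) exp (-β (ε j - ε 0))`. -/
theorem expect_occupation_pair_bounds (ε : ℕ → ℝ) (hmono : Monotone ε) (hgap : ε 0 < ε 1)
    (htrace : ∀ β : ℝ, 0 < β → Summable fun j => Real.exp (-β * ε j))
    (β : ℝ) (hβ : 0 < β) :
    ∃ c : ℝ, 0 < c ∧ ∀ N i j : ℕ, 1 ≤ i → 1 ≤ j → i ≠ j →
      (expect ε β N (fun n : ℕ →₀ ℕ => (n i : ℝ) * ((n i : ℝ) - 1)) ≤
        c * Real.exp (-2 * β * (ε i - ε 0))) ∧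
      (expect ε β N (fun n : ℕ →₀ ℕ => (n i : ℝ) * (n j : ℝ)) ≤
        c * Real.exp (-β * (ε i - ε 0)) * Real.exp (-β * (ε j - ε 0))) := by
  set q : ℝ := Real.exp (-β * (ε 1 - ε 0)) with hq_def
  have hq : q < 1 := Real.exp_lt_one_iff.2 (by nlinarith)
  have hx : ∀ i, 1 ≤ i → Real.exp (-β * (ε i - ε 0)) ≤ q := fun i hi =>
    Real.exp_le_exp.2 (by nlinarith [hmono hi])
  have h1 : 0 < 1 - q := by linarith
  refine ⟨2 / (1 - q) ^ 2, by positivity, fun N i j hi hj hij => ⟨?_, ?_⟩⟩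
  · calc expect ε β N (fun n : ℕ →₀ ℕ => (n i : ℝ) * ((n i : ℝ) - 1))
        ≤ ∑ a ∈ Finset.range N, 2 * (a : ℝ) * Real.exp
            (-β * (energy ε (Finsupp.single i (a + 1)) -
              particleNumber (Finsupp.single i (a + 1)) * ε 0)) := by
          refine expect_le_of_eq_sum ε β N _ _ _ _ (fun a => by positivity) fun n hn => ?_
          simp only [Finsupp.single_le_iff]
          rw [sum_range_ite_lt N (n i) (hn ▸ apply_le_particleNumber n i), sum_range_two_mul]
      _ = ∑ a ∈ Finset.range N, 2 * (a : ℝ) * Real.exp (-β * (ε i - ε 0)) ^ (a + 1) := by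
          refine Finset.sum_congr rfl fun a _ => ?_
          rw [energy_single, particleNumber_single, ← Real.exp_nat_mul]
          ring_nf
      _ ≤ 2 / (1 - q) ^ 2 * Real.exp (-β * (ε i - ε 0)) ^ 2 :=
          sum_range_two_mul_pow_succ_le (Real.exp_pos _).le (hx i hi) hq N
      _ = 2 / (1 - q) ^ 2 * Real.exp (-2 * β * (ε i - ε 0)) := by
          rw [← Real.exp_nat_mul]
          push_cast
          ring_nf
  · have hle : ∀ (a b : ℕ) (n : ℕ →₀ ℕ), Finsupp.single i a + Finsupp.single j b ≤ n ↔
        a ≤ n i ∧ b ≤ n j := fun a b n => by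
      constructor
      · intro h
        have h₁ := h i
        have h₂ := h j
        simp [hij, hij.symm] at h₁ h₂
        exact ⟨h₁, h₂⟩
      · rintro ⟨h₁, h₂⟩ k
        by_cases hki : k = i
        · subst hki; simpa [hij] using h₁
        · by_cases hkj : k = j
          · subst hkj; simpa [hki] using h₂
          · simp [hki, hkj]
    calc expect ε β N (fun n : ℕ →₀ ℕ => (n i : ℝ) * (n j : ℝ))
        ≤ ∑ a ∈ Finset.range N ×ˢ Finset.range N, 1 * Real.exp
            (-β * (energy ε (Finsupp.single i (a.1 + 1) + Finsupp.single j (a.2 + 1)) -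
              particleNumber (Finsupp.single i (a.1 + 1) + Finsupp.single j (a.2 + 1)) *
                ε 0)) := by
          refine expect_le_of_eq_sum ε β N _ _ (fun _ => 1) _ (fun _ => zero_le_one)
            fun n hn => ?_
          have hcount : ∀ k, (n k : ℝ) =
              ∑ a ∈ Finset.range N, if a + 1 ≤ n k then (1 : ℝ) else 0 := fun k => by
            have := sum_range_ite_lt N (n k) (hn ▸ apply_le_particleNumber n k) fun _ => 1
            simpa using this.symm
          rw [hcount i, hcount j, Finset.sum_mul_sum, Finset.sum_product]
          refine Finset.sum_congr rfl fun a _ => Finset.sum_congr rfl fun b _ => ?_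
          simp only [hle, ite_and, one_mul, ite_mul, zero_mul]
      _ = (∑ a ∈ Finset.range N, Real.exp (-β * (ε i - ε 0)) ^ (a + 1)) *
            ∑ b ∈ Finset.range N, Real.exp (-β * (ε j - ε 0)) ^ (b + 1) := by
          rw [Finset.sum_mul_sum, Finset.sum_product]
          refine Finset.sum_congr rfl fun a _ => Finset.sum_congr rfl fun b _ => ?_
          rw [energy_add, particleNumber_add, energy_single, energy_single,
            particleNumber_single, particleNumber_single, ← Real.exp_nat_mul,
            ← Real.exp_nat_mul, ← Real.exp_add, one_mul]
          push_cast
          ring_nf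
      _ ≤ (Real.exp (-β * (ε i - ε 0)) * (1 - q)⁻¹) *
            (Real.exp (-β * (ε j - ε 0)) * (1 - q)⁻¹) :=
          mul_le_mul (sum_range_pow_succ_le (Real.exp_pos _).le (hx i hi) hq N)
            (sum_range_pow_succ_le (Real.exp_pos _).le (hx j hj) hq N)
            (Finset.sum_nonneg fun _ _ => by positivity) (by positivity)
      _ = 1 / (1 - q) ^ 2 * Real.exp (-β * (ε i - ε 0)) * Real.exp (-β * (ε j - ε 0)) := by
          field_simp
      _ ≤ 2 / (1 - q) ^ 2 * Real.exp (-β * (ε i - ε 0)) * Real.exp (-β * (ε j - ε 0)) := by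
          gcongr
          norm_num
end
end
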